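/- arXiv:2404.00782 — 6 statements merged into one kernel-verified Lean document; each statement's English description precedes it below -/
import Mathlib

section
/- Let (X,d) be a complete metric space with at least three points and let T : X → X satisfy: (i) T(Tx) ≠ x for all x ∈ X with Tx ≠ x, and (ii) T is a generalized Chatterjea type mapping on X. Then T has a fixed point. -/
/-- A generalized Chatterjea type mapping on a complete metric space with at least three
points, having no periodic points of prime period two, has a fixed point. -/
theorem generalized_chatterjea_fixed_point
    {X : Type*} [MetricSpace X] [CompleteSpace X]
    (hX : ∃ a b c : X, a ≠ b ∧ b ≠ c ∧ a ≠ c)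
    (T : X → X)
    (hper : ∀ x : X, T x ≠ x → T (T x) ≠ x)
    (hGC : ∃ lam : ℝ, 0 ≤ lam ∧ lam < 1 / 2 ∧
      ∀ x y z : X, x ≠ y → y ≠ z → x ≠ z →
        dist (T x) (T y) + dist (T y) (T z) + dist (T z) (T x) ≤
          lam * (dist x (T y) + dist y (T x) + dist y (T z) + dist z (T x)
            + dist z (T y) + dist x (T z))) :
    ∃ x : X, T x = x := by
  obtain ⟨lam, hlam0, hlam, hT⟩ := hGC
  by_contra! hfix
  have hper' : ∀ x, T (T x) ≠ x := fun x => hper x (hfix x)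
  obtain ⟨x₀, -⟩ := hX
  set u : ℕ → X := fun n => T^[n] x₀ with hu
  have hsucc : ∀ n, T (u n) = u (n + 1) := fun n => (Function.iterate_succ_apply' T n x₀).symm
  have hne₁ : ∀ n, u n ≠ u (n + 1) := fun n => hsucc n ▸ (hfix (u n)).symm
  have hne₂ : ∀ n, u n ≠ u (n + 2) := fun n => by
    rw [← hsucc (n + 1), ← hsucc n]
    exact (hper' (u n)).symm
  have hlim : ∃ a, Filter.Tendsto u Filter.atTop (nhds a) := by
    -- The perimeters of the triangles of consecutive iterates decay geometrically.
    set p : ℕ → ℝ := fun n =>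
      dist (u n) (u (n + 1)) + dist (u (n + 1)) (u (n + 2)) + dist (u n) (u (n + 2)) with hp
    have hstep : ∀ n, p (n + 1) ≤ lam / (1 - lam) * p n := fun n => by
      rw [div_mul_eq_mul_div, le_div_iff₀ (by linarith)]
      have h := hT (u n) (u (n + 1)) (u (n + 2)) (hne₁ n) (hne₁ (n + 1)) (hne₂ n)
      simp only [hsucc, dist_self] at h
      have h₁ := dist_triangle (u n) (u (n + 1)) (u (n + 3))
      have h₂ := dist_triangle (u (n + 1)) (u (n + 2)) (u (n + 3))
      rw [dist_comm (u (n + 2 + 1)), dist_comm (u (n + 2)) (u (n + 1))] at h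
      simp only [hp, add_assoc, Nat.reduceAdd] at h ⊢
      nlinarith
    have hr : 0 ≤ lam / (1 - lam) := div_nonneg hlam0 (by linarith)
    have hr₁ : lam / (1 - lam) < 1 := (div_lt_one (by linarith)).2 (by linarith)
    have hgeom : ∀ n, p n ≤ p 0 * (lam / (1 - lam)) ^ n := fun n => by
      induction n with
      | zero => simp
      | succ n ih =>
        calc p (n + 1) ≤ lam / (1 - lam) * p n := hstep n
          _ ≤ lam / (1 - lam) * (p 0 * (lam / (1 - lam)) ^ n) := by gcongr
          _ = p 0 * (lam / (1 - lam)) ^ (n + 1) := by ring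
    refine cauchySeq_tendsto_of_complete
      (cauchySeq_of_le_geometric _ (p 0) hr₁ fun n => le_trans ?_ (hgeom n))
    simp only [hp, add_assoc]
    exact le_add_of_nonneg_right (by positivity)
  obtain ⟨a, ha⟩ := hlim
  have ha₁ := ha.comp (Filter.tendsto_add_atTop_nat 1)
  have ha₂ := ha.comp (Filter.tendsto_add_atTop_nat 2)
  have hca := tendsto_const_nhds (x := a) (f := (Filter.atTop : Filter ℕ))
  have hcT := tendsto_const_nhds (x := T a) (f := (Filter.atTop : Filter ℕ))
  have hfreq : ∃ᶠ n in Filter.atTop, a ≠ u n ∧ a ≠ u (n + 1) := by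
    refine Filter.frequently_atTop.2 fun N => ?_
    by_cases h₀ : a = u N
    · exact ⟨N + 1, by omega, h₀ ▸ hne₁ N, h₀ ▸ hne₂ N⟩
    by_cases h₁ : a = u (N + 1)
    · exact ⟨N + 2, by omega, h₁ ▸ hne₁ (N + 1), h₁ ▸ hne₂ (N + 1)⟩
    · exact ⟨N, le_rfl, h₀, h₁⟩
  have hle := le_of_tendsto_of_tendsto_of_frequently
    (((hcT.dist ha₁).add (ha₁.dist ha₂)).add (ha₂.dist hcT))
    ((((((hca.dist ha₁).add (ha.dist hcT)).add (ha.dist ha₂)).add (ha₁.dist hcT)).add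
      (ha₁.dist ha₁)).add (hca.dist ha₂) |>.const_mul lam)
    (hfreq.mono fun n hn => by
      have h := hT a (u n) (u (n + 1)) hn.1 (hne₁ n) hn.2
      simp only [hsucc] at h
      exact h)
  simp only [dist_self, dist_comm a (T a)] at hle
  nlinarith [dist_pos.2 (hfix a)]
end

section
/- Let (X,d) be a metric space with at least three points and let T : X → X be a generalized Chatterjea type mapping on X. Then T has at most two fixed points, i.e. there do not exist three pairwise distinct points x, y, z ∈ X with Tx = x, Ty = y and Tz = z. -/
/-- A generalized Chatterjea type mapping on a metric space with at least three points has at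
most two fixed points. -/
theorem generalized_chatterjea_at_most_two_fixed_points
    {X : Type*} [MetricSpace X]
    (hX : ∃ a b c : X, a ≠ b ∧ b ≠ c ∧ a ≠ c)
    (T : X → X)
    (hGC : ∃ lam : ℝ, 0 ≤ lam ∧ lam < 1 / 2 ∧
      ∀ x y z : X, x ≠ y → y ≠ z → x ≠ z →
        dist (T x) (T y) + dist (T y) (T z) + dist (T z) (T x) ≤
          lam * (dist x (T y) + dist y (T x) + dist y (T z) + dist z (T x)
            + dist z (T y) + dist x (T z))) :
    ¬ ∃ x y z : X, x ≠ y ∧ y ≠ z ∧ x ≠ z ∧ T x = x ∧ T y = y ∧ T z = z := by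
  obtain ⟨lam, -, hlam, h⟩ := hGC
  rintro ⟨x, y, z, hxy, hyz, hxz, hx, hy, hz⟩
  have hle := h x y z hxy hyz hxz
  rw [hx, hy, hz, dist_comm y x, dist_comm z y, dist_comm z x] at hle
  have hpos : 0 < dist x y + dist y z + dist x z := by
    have := dist_pos.2 hxy
    positivity
  nlinarith [mul_pos (sub_pos.2 hlam) hpos]
end

section
/- Let (X,d) be a metric space with at least three points, let T : X → X be a generalized Chatterjea type mapping on X, and suppose T has a fixed point x* which is the limit of some iteration sequence x₀, x₁ = Tx₀, x₂ = Tx₁, … such that xₙ ≠ x* for all n ≥ 1. Then x* is the unique fixed point of T. -/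
/-- If a generalized Chatterjea type mapping has a fixed point `xs` which is the limit of an
iteration sequence whose terms (from index 1 on) all differ from `xs`, then `xs` is the unique
fixed point. -/
theorem generalized_chatterjea_unique_fixed_point_of_limit
    {X : Type*} [MetricSpace X]
    (hX : ∃ a b c : X, a ≠ b ∧ b ≠ c ∧ a ≠ c)
    (T : X → X)
    (hGC : ∃ lam : ℝ, 0 ≤ lam ∧ lam < 1 / 2 ∧
      ∀ x y z : X, x ≠ y → y ≠ z → x ≠ z →
        dist (T x) (T y) + dist (T y) (T z) + dist (T z) (T x) ≤
          lam * (dist x (T y) + dist y (T x) + dist y (T z) + dist z (T x)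
            + dist z (T y) + dist x (T z)))
    (xs : X) (hfix : T xs = xs)
    (u : ℕ → X) (hiter : ∀ n : ℕ, u (n + 1) = T (u n))
    (hne : ∀ n : ℕ, 1 ≤ n → u n ≠ xs)
    (hlim : Filter.Tendsto u Filter.atTop (nhds xs)) :
    ∀ y : X, T y = y → y = xs := by
  intro y hy
  by_contra hyx
  obtain ⟨lam, -, hlam, hT⟩ := hGC
  have hTu : Filter.Tendsto (fun n => T (u n)) Filter.atTop (nhds xs) := by
    simpa only [Function.comp_def, hiter] using hlim.comp (Filter.tendsto_add_atTop_nat 1)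
  have hle : ∀ᶠ n in Filter.atTop,
      dist xs y + dist y (T (u n)) + dist (T (u n)) xs ≤
        lam * (dist xs y + dist y xs + dist y (T (u n)) + dist (u n) xs
          + dist (u n) y + dist xs (T (u n))) := by
    filter_upwards [hlim.eventually_ne (Ne.symm hyx), Filter.eventually_ge_atTop 1]
      with n hny hn
    simpa only [hfix, hy] using hT xs y (u n) (Ne.symm hyx) hny.symm (hne n hn).symm
  have hleft : Filter.Tendsto
      (fun n => dist xs y + dist y (T (u n)) + dist (T (u n)) xs) Filter.atTop
      (nhds (dist xs y + dist y xs + dist xs xs)) :=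
    (tendsto_const_nhds.add (tendsto_const_nhds.dist hTu)).add (hTu.dist tendsto_const_nhds)
  have hright : Filter.Tendsto
      (fun n => lam * (dist xs y + dist y xs + dist y (T (u n)) + dist (u n) xs
        + dist (u n) y + dist xs (T (u n)))) Filter.atTop
      (nhds (lam * (dist xs y + dist y xs + dist y xs + dist xs xs
        + dist xs y + dist xs xs))) :=
    ((((tendsto_const_nhds.add (tendsto_const_nhds.dist hTu)).add
      (hlim.dist tendsto_const_nhds)).add (hlim.dist tendsto_const_nhds)).add
      (tendsto_const_nhds.dist hTu)).const_mul lam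
  have hlimit := le_of_tendsto_of_tendsto hleft hright hle
  rw [dist_self, dist_comm xs y] at hlimit
  have hpos : 0 < dist y xs := dist_pos.mpr hyx
  nlinarith
end

section
/- Let (X,d) be a metric space with at least three points and let T : X → X satisfy the generalized Chatterjea inequality with constant λ ∈ [0, 1/2). If a, b = Ta and c = Tb are pairwise distinct, then d(b,c) + d(b,Tc) + d(c,Tc) ≤ (λ/(1−λ)) · [d(a,b) + d(a,c) + d(b,c)], i.e. the perimeter of the triangle formed by three consecutive iterates decreases by the factor λ/(1−λ) ∈ [0,1). -/
/-- For a mapping satisfying the generalized Chatterjea inequality with constant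
`lam ∈ [0, 1/2)`, the perimeter of the triangle formed by three consecutive iterates
decreases by the factor `lam / (1 - lam)`. -/
theorem generalized_chatterjea_perimeter_decreases
    {X : Type*} [MetricSpace X]
    (hX : ∃ a b c : X, a ≠ b ∧ b ≠ c ∧ a ≠ c)
    (T : X → X) (lam : ℝ) (hlam0 : 0 ≤ lam) (hlam1 : lam < 1 / 2)
    (hGC : ∀ x y z : X, x ≠ y → y ≠ z → x ≠ z →
      dist (T x) (T y) + dist (T y) (T z) + dist (T z) (T x) ≤
        lam * (dist x (T y) + dist y (T x) + dist y (T z) + dist z (T x)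
          + dist z (T y) + dist x (T z)))
    (a b c : X) (hb : b = T a) (hc : c = T b)
    (hab : a ≠ b) (hbc : b ≠ c) (hac : a ≠ c) :
    dist b c + dist b (T c) + dist c (T c) ≤
      lam / (1 - lam) * (dist a b + dist a c + dist b c) := by
  subst hb hc
  have key := hGC a (T a) (T (T a)) hab hbc hac
  simp only [dist_self, dist_comm (T (T (T a))) (T a), dist_comm (T (T a)) (T a)] at key
  have path := mul_le_mul_of_nonneg_left
    (dist_triangle4 a (T a) (T (T a)) (T (T (T a)))) hlam0
  rw [div_mul_eq_mul_div, le_div_iff₀ (by linarith)]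
  linarith
end

section
/- Let (X,d) be a metric space with at least three points and let T : X → X satisfy: (i) T(Tx) ≠ x for all x ∈ X with Tx ≠ x, and (ii) T is a generalized Chatterjea type mapping on X. Fix x₀ ∈ X and define xₙ₊₁ = Txₙ for all n ≥ 0. If xₙ is not a fixed point of T for every n ≥ 0, then the sequence (xₙ) is a Cauchy sequence. -/
/-- For a generalized Chatterjea type mapping with no periodic points of prime period two,
any iteration sequence none of whose terms is a fixed point is a Cauchy sequence. -/
theorem generalized_chatterjea_iteration_cauchy
    {X : Type*} [MetricSpace X]
    (hX : ∃ a b c : X, a ≠ b ∧ b ≠ c ∧ a ≠ c)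
    (T : X → X)
    (hper : ∀ x : X, T x ≠ x → T (T x) ≠ x)
    (hGC : ∃ lam : ℝ, 0 ≤ lam ∧ lam < 1 / 2 ∧
      ∀ x y z : X, x ≠ y → y ≠ z → x ≠ z →
        dist (T x) (T y) + dist (T y) (T z) + dist (T z) (T x) ≤
          lam * (dist x (T y) + dist y (T x) + dist y (T z) + dist z (T x)
            + dist z (T y) + dist x (T z)))
    (u : ℕ → X) (hiter : ∀ n : ℕ, u (n + 1) = T (u n))
    (hnotfix : ∀ n : ℕ, T (u n) ≠ u n) :
    CauchySeq u := by
  obtain ⟨lam, hlam0, hlam, hT⟩ := hGC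
  set p : ℕ → ℝ := fun n ↦
    dist (u n) (u (n + 1)) + dist (u (n + 1)) (u (n + 2)) + dist (u (n + 2)) (u n) with hp
  have hstep : ∀ n, p (n + 1) ≤ lam / (1 - lam) * p n := by
    intro n
    have hne : ∀ m, u m ≠ u (m + 1) := fun m ↦ by
      rw [hiter]; exact (hnotfix m).symm
    have hne₂ : u n ≠ u (n + 2) := by
      rw [hiter (n + 1), hiter n]; exact (hper _ (hnotfix n)).symm
    have h := hT (u n) (u (n + 1)) (u (n + 2)) (hne n) (hne (n + 1)) hne₂
    simp only [← hiter, add_assoc, Nat.reduceAdd, dist_self] at h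
    have hfar := dist_triangle (u n) (u (n + 2)) (u (n + 3))
    have hskip := dist_triangle (u n) (u (n + 1)) (u (n + 2))
    rw [div_mul_eq_mul_div, le_div_iff₀ (by linarith)]
    simp only [hp, add_assoc, Nat.reduceAdd]
    rw [dist_comm (u (n + 2)) (u (n + 1))] at h
    rw [dist_comm (u (n + 3)) (u (n + 1))] at h ⊢
    rw [dist_comm (u (n + 2)) (u n)]
    have hfar' := mul_le_mul_of_nonneg_left hfar hlam0
    have hskip' := mul_le_mul_of_nonneg_left hskip hlam0
    linarith
  have hr : 0 ≤ lam / (1 - lam) := div_nonneg hlam0 (by linarith)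
  have hr1 : lam / (1 - lam) < 1 := by
    rw [div_lt_one (by linarith)]; linarith
  have hgeom : ∀ n, p n ≤ p 0 * (lam / (1 - lam)) ^ n := by
    intro n
    induction n with
    | zero => simp
    | succ n ih =>
      calc p (n + 1) ≤ lam / (1 - lam) * p n := hstep n
        _ ≤ lam / (1 - lam) * (p 0 * (lam / (1 - lam)) ^ n) := by gcongr
        _ = p 0 * (lam / (1 - lam)) ^ (n + 1) := by ring
  refine cauchySeq_of_le_geometric _ (p 0) hr1 fun n ↦ le_trans ?_ (hgeom n)
  simp only [hp, add_assoc (dist _ _)]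
  exact le_add_of_nonneg_right (by positivity)
end

section
/- Let T : ℝ → ℝ (with the usual metric d(x,y) = |x − y|) be defined by Tx = 0 if x < 2 and Tx = 1 if x ≥ 2. Then T is a generalized Chatterjea type mapping with constant λ = 1/3, i.e. |Tx − Ty| + |Ty − Tz| + |Tz − Tx| ≤ (1/3)·[|x − Ty| + |y − Tx| + |y − Tz| + |z − Tx| + |z − Ty| + |x − Tz|] for all three pairwise distinct x, y, z ∈ ℝ. -/
/-- The mapping `T : ℝ → ℝ` with `T x = 0` for `x < 2` and `T x = 1` for `x ≥ 2` is a
generalized Chatterjea type mapping with constant `1/3`. -/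
theorem step_map_generalized_chatterjea
    (T : ℝ → ℝ) (hT : ∀ x : ℝ, T x = if x < 2 then 0 else 1) :
    ∀ x y z : ℝ, x ≠ y → y ≠ z → x ≠ z →
      |T x - T y| + |T y - T z| + |T z - T x| ≤
        (1 / 3 : ℝ) * (|x - T y| + |y - T x| + |y - T z| + |z - T x|
          + |z - T y| + |x - T z|) := by
  intro x y z _ _ _
  have lower_bound (t : ℝ) : 1 ≤ |t| + |t - 1| := by
    linarith [le_abs_self t, neg_le_abs (t - 1)]
  simp only [hT]
  split_ifs <;> norm_num <;>
    first
    | positivity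
    | linarith [lower_bound x, lower_bound y, lower_bound z,
        le_abs_self x, le_abs_self y, le_abs_self z,
        le_abs_self (x - 1), le_abs_self (y - 1), le_abs_self (z - 1),
        abs_nonneg (x - 1), abs_nonneg (y - 1), abs_nonneg (z - 1)]
end
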